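/- arXiv:1504.03666 — 2 statements merged into one kernel-verified Lean document; each statement's English description precedes it below -/
import Mathlib

section
/- For every natural number k, the maximum cut size of CC_k equals ⌊(10k² + 18k + 9)/12⌋, i.e., ⌊5k²/6 + 3k/2 + 3/4⌋. -/
/-- The cut size of a cut `S` of a finite simple graph `G`: the number of edges of `G` with
exactly one endpoint in `S` (counted as ordered pairs whose first component is in `S`). -/
def cutSize {V : Type*} [Fintype V] [DecidableEq V] (G : SimpleGraph V) [DecidableRel G.Adj]
    (S : Finset V) : ℕ :=
  ((Finset.univ : Finset (V × V)).filter fun p => G.Adj p.1 p.2 ∧ p.1 ∈ S ∧ p.2 ∉ S).card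

/-- The maximum cut size of a finite simple graph `G`. -/
def maxCut {V : Type*} [Fintype V] [DecidableEq V] (G : SimpleGraph V) [DecidableRel G.Adj] : ℕ :=
  Finset.univ.powerset.sup fun S => cutSize G S

def ccRel (k : ℕ) : (Fin (k+1) ⊕ Fin (k+1)) → (Fin (k+1) ⊕ Fin (k+1)) → Prop
  | Sum.inl _, Sum.inl _ => True
  | Sum.inr _, Sum.inr _ => True
  | Sum.inl i, Sum.inr j => (j : ℕ) < (i : ℕ)
  | Sum.inr _, Sum.inl _ => False

instance (k : ℕ) : DecidableRel (ccRel k) := fun u v =>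
  match u, v with
  | Sum.inl _, Sum.inl _ => inferInstanceAs (Decidable True)
  | Sum.inr _, Sum.inr _ => inferInstanceAs (Decidable True)
  | Sum.inl i, Sum.inr j => inferInstanceAs (Decidable ((j : ℕ) < (i : ℕ)))
  | Sum.inr _, Sum.inl _ => inferInstanceAs (Decidable False)

/-- The graph `CC_k`: vertices `v_0,…,v_k` (encoded `Sum.inl i`) and `v'_0,…,v'_k`
(encoded `Sum.inr j`); each side is a clique and `v_i ~ v'_j` iff `j < i`. -/
def CCk (k : ℕ) : SimpleGraph (Fin (k+1) ⊕ Fin (k+1)) := SimpleGraph.fromRel (ccRel k)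

instance (k : ℕ) : DecidableRel (CCk k).Adj := fun u v =>
  inferInstanceAs (Decidable (u ≠ v ∧ (ccRel k u v ∨ ccRel k v u)))

theorem CCk_adj_inl_inl {k : ℕ} {i j : Fin (k+1)} :
    (CCk k).Adj (Sum.inl i) (Sum.inl j) ↔ i ≠ j := by
  simp [CCk, ccRel]

theorem CCk_adj_inr_inr {k : ℕ} {i j : Fin (k+1)} :
    (CCk k).Adj (Sum.inr i) (Sum.inr j) ↔ i ≠ j := by
  simp [CCk, ccRel]

theorem CCk_adj_inl_inr {k : ℕ} {i j : Fin (k+1)} :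
    (CCk k).Adj (Sum.inl i) (Sum.inr j) ↔ (j : ℕ) < i := by
  simp [CCk, ccRel]

open Finset in
/-- The cut size of `CC_k` in terms of the `±1` indicator sequences of the two cliques. -/
theorem four_mul_cutSize_CCk (k : ℕ) (S : Finset (Fin (k+1) ⊕ Fin (k+1))) (x y : ℕ → ℤ)
    (hx : ∀ i : Fin (k+1), x i = if Sum.inl i ∈ S then 1 else -1)
    (hy : ∀ i : Fin (k+1), y i = if Sum.inr i ∈ S then 1 else -1) :
    4 * (cutSize (CCk k) S : ℤ) = 3 * (k + 1) ^ 2 - (k + 1) - (∑ i ∈ range (k+1), x i) ^ 2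
      - (∑ i ∈ range (k+1), y i) ^ 2 - 2 * ∑ i ∈ range (k+1), x i * ∑ j ∈ range i, y j := by
  have clique (z : ℕ → ℤ) : ∑ i : Fin (k+1), ∑ j : Fin (k+1), (1 + z i) * (1 - z j)
      = (k + 1) ^ 2 - (∑ i ∈ range (k+1), z i) ^ 2 := by
    rw [← Finset.sum_mul_sum, Fin.sum_univ_eq_sum_range (fun i => 1 + z i),
      Fin.sum_univ_eq_sum_range (fun i => 1 - z i), Finset.sum_add_distrib,
      Finset.sum_sub_distrib]
    simp
    ring
  have cross : ∑ i : Fin (k+1), ∑ j : Fin (k+1),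
      (if (j : ℕ) < i then 2 - 2 * (x i * y j) else 0)
      = (k + 1) * k - 2 * ∑ i ∈ range (k+1), x i * ∑ j ∈ range i, y j := by
    have inner (i : ℕ) (hi : i ∈ range (k+1)) :
        ∑ j ∈ range (k+1), (if j < i then 2 - 2 * (x i * y j) else 0)
        = 2 * (i : ℤ) - 2 * (x i * ∑ j ∈ range i, y j) := by
      have hf : (range (k+1)).filter (· < i) = range i := by
        ext j
        simp only [mem_filter, mem_range] at *
        omega
      rw [← Finset.sum_filter, hf, Finset.sum_sub_distrib, ← Finset.mul_sum, ← Finset.mul_sum]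
      simp
      ring
    simp_rw [fun i : Fin (k+1) => Fin.sum_univ_eq_sum_range
      (fun j => if j < (i : ℕ) then 2 - 2 * (x i * y j) else 0) (k+1)]
    rw [Fin.sum_univ_eq_sum_range (fun i => ∑ j ∈ range (k+1),
      (if j < i then 2 - 2 * (x i * y j) else 0)) (k+1), Finset.sum_congr rfl inner,
      Finset.sum_sub_distrib, ← Finset.mul_sum, ← Finset.mul_sum]
    have gauss := Finset.sum_range_id_mul_two (k+1)
    rw [Nat.add_sub_cancel] at gauss
    zify at gauss
    linarith
  have key : 4 * (cutSize (CCk k) S : ℤ)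
      = ∑ i : Fin (k+1), ∑ j : Fin (k+1), (1 + x i) * (1 - x j)
      + ∑ i : Fin (k+1), ∑ j : Fin (k+1), (1 + y i) * (1 - y j)
      + ∑ i : Fin (k+1), ∑ j : Fin (k+1),
        (if (j : ℕ) < i then 2 - 2 * (x i * y j) else 0) := by
    rw [cutSize, Finset.card_filter, Fintype.sum_prod_type]
    simp only [Fintype.sum_sum_type]
    push_cast
    simp only [Finset.sum_add_distrib]
    rw [Finset.sum_comm (f := fun (i j : Fin (k+1)) =>
      if (CCk k).Adj (Sum.inr i) (Sum.inl j) ∧ Sum.inr i ∈ S ∧ Sum.inl j ∉ S then (1 : ℤ) else 0)]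
    have h1 : ∀ i j : Fin (k+1), 4 * (if (CCk k).Adj (Sum.inl i) (Sum.inl j) ∧ Sum.inl i ∈ S ∧
        Sum.inl j ∉ S then (1 : ℤ) else 0) = (1 + x i) * (1 - x j) := by
      intro i j
      simp only [hx, CCk_adj_inl_inl]
      by_cases hij : i = j
      · subst hij
        by_cases hi : Sum.inl i ∈ S <;> simp [hi]
      · by_cases hi : Sum.inl i ∈ S <;> by_cases hj : Sum.inl j ∈ S <;> simp [hi, hj, hij]
    have h2 : ∀ i j : Fin (k+1), 4 * (if (CCk k).Adj (Sum.inr i) (Sum.inr j) ∧ Sum.inr i ∈ S ∧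
        Sum.inr j ∉ S then (1 : ℤ) else 0) = (1 + y i) * (1 - y j) := by
      intro i j
      simp only [hy, CCk_adj_inr_inr]
      by_cases hij : i = j
      · subst hij
        by_cases hi : Sum.inr i ∈ S <;> simp [hi]
      · by_cases hi : Sum.inr i ∈ S <;> by_cases hj : Sum.inr j ∈ S <;> simp [hi, hj, hij]
    have h3 : ∀ i j : Fin (k+1),
        4 * (if (CCk k).Adj (Sum.inl i) (Sum.inr j) ∧ Sum.inl i ∈ S ∧
          Sum.inr j ∉ S then (1 : ℤ) else 0)
        + 4 * (if (CCk k).Adj (Sum.inr j) (Sum.inl i) ∧ Sum.inr j ∈ S ∧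
          Sum.inl i ∉ S then (1 : ℤ) else 0)
        = if (j : ℕ) < i then 2 - 2 * (x i * y j) else 0 := by
      intro i j
      simp only [hx, hy, (CCk k).adj_comm (Sum.inr j), CCk_adj_inl_inr]
      by_cases hij : (j : ℕ) < i <;> by_cases hi : Sum.inl i ∈ S <;>
        by_cases hj : Sum.inr j ∈ S <;> simp [hi, hj, hij]
    simp only [← h1, ← h2, ← h3, Finset.sum_add_distrib, ← Finset.mul_sum]
    ring
  rw [key, clique, clique, cross]
  ring

open Finset in
/-- In the coordinates `u = (A + B) / 2`, `w = (B - A) / 2`, where `A`, `B` are the partial sums of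
two sign sequences, every step moves exactly one coordinate by `±1`. This records the numbers
`h`, `vp`, `vm` of `u`-steps, up- and down-`w`-steps, bounds `m ≤ u ≤ M` along the walk, and the
integral `I` of `u` against `w`. -/
theorem exists_walk_data (x y : ℕ → ℤ) (hx : ∀ i, x i = 1 ∨ x i = -1)
    (hy : ∀ i, y i = 1 ∨ y i = -1) (n : ℕ) :
    ∃ u h vp vm M m I : ℤ, ∑ i ∈ range n, x i = u - (vp - vm) ∧
      ∑ i ∈ range n, y i = u + (vp - vm) ∧ (n : ℤ) = h + vp + vm ∧ 0 ≤ vp ∧ 0 ≤ vm ∧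
      m ≤ 0 ∧ 0 ≤ M ∧ m ≤ u ∧ u ≤ M ∧ 2 * (M - m) ≤ h + |u| ∧ I ≤ M * vp - m * vm ∧
      2 * ∑ i ∈ range n, x i * ∑ j ∈ range i, y j =
        u ^ 2 - (vp - vm) ^ 2 - 4 * I + 2 * u * (vp - vm) - h + (vp + vm) := by
  induction n with
  | zero => exact ⟨0, 0, 0, 0, 0, 0, 0, by simp⟩
  | succ n ih =>
    obtain ⟨u, h, vp, vm, M, m, I, hX, hY, hn, hvp, hvm, hm, hM, hmu, huM, hh, hI, hT⟩ := ih
    simp only [Finset.sum_range_succ _ n]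
    push_cast
    rw [mul_add, hT, hX, hY, hn]
    rcases hx n with h1 | h1 <;> rcases hy n with h2 | h2 <;> rw [h1, h2]
    · refine ⟨u + 1, h + 1, vp, vm, max M (u + 1), m, I, by ring, by ring, by ring, hvp, hvm, hm,
        by omega, by omega, by omega, by grind, ?_, by ring⟩
      nlinarith [le_max_left M (u + 1)]
    · exact ⟨u, h, vp, vm + 1, M, m, I - u, by ring, by ring, by ring, by omega, by omega, hm, hM,
        hmu, huM, hh, by linarith, by ring⟩
    · exact ⟨u, h, vp + 1, vm, M, m, I + u, by ring, by ring, by ring, by omega, by omega, hm, hM,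
        hmu, huM, hh, by linarith, by ring⟩
    · refine ⟨u - 1, h + 1, vp, vm, M, min m (u - 1), I, by ring, by ring, by ring, hvp, hvm,
        by omega, by omega, by omega, by omega, by grind, ?_, by ring⟩
      nlinarith [min_le_left m (u - 1)]

theorem walk_quadratic_nonneg {a s t : ℤ} (hs : 0 ≤ s) :
    0 ≤ 9 * a ^ 2 - 3 * a * s + 3 * s ^ 2 + 3 * t * s + (t - 1) ^ 2 := by
  rcases le_total 0 t with ht | ht
  · nlinarith [mul_nonneg ht hs, sq_nonneg (6 * a - s), sq_nonneg (t - 1), sq_nonneg s]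
  · nlinarith [sq_nonneg (6 * a - s), sq_nonneg (2 * t + 3 * s), sq_nonneg s]

/-- The area bound for walks; `a` stands for `|u|`, and `vp - vm` may have either sign. -/
theorem walk_area_le {u h vp vm M m I : ℤ} (hvp : 0 ≤ vp) (hvm : 0 ≤ vm) (hm : m ≤ 0)
    (hM : 0 ≤ M) (hmu : m ≤ u) (huM : u ≤ M) (hh : 2 * (M - m) ≤ h + |u|)
    (hI : I ≤ M * vp - m * vm) :
    0 ≤ 9 * u ^ 2 + 3 * (vp - vm) ^ 2 - 12 * I + 6 * u * (vp - vm) - 3 * h + 3 * (vp + vm)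
      + (h + vp + vm) ^ 2 + (h + vp + vm) + 1 := by
  have hα : |u| ≤ 2 * M - u := by grind
  have hβ : |u| ≤ u - 2 * m := by grind
  have ha := sq_abs u
  rcases le_total vm vp with hv | hv
  · have hb : (2 * M - u) * vp + (u - 2 * m) * vm ≤ h * vp + |u| * vm := by
      nlinarith [mul_nonneg (sub_nonneg.2 hβ) (sub_nonneg.2 hv),
        mul_nonneg (sub_nonneg.2 hh) hvp]
    have := walk_quadratic_nonneg (a := |u|) (s := 2 * vm) (t := h - 2 * (vp + vm)) (by omega)
    nlinarith
  · have hb : (2 * M - u) * vp + (u - 2 * m) * vm ≤ h * vm + |u| * vp := by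
      nlinarith [mul_nonneg (sub_nonneg.2 hα) (sub_nonneg.2 hv),
        mul_nonneg (sub_nonneg.2 hh) hvm]
    have := walk_quadratic_nonneg (a := |u|) (s := 2 * vp) (t := h - 2 * (vp + vm)) (by omega)
    nlinarith

theorem twelve_mul_cutSize_CCk_le (k : ℕ) (S : Finset (Fin (k+1) ⊕ Fin (k+1))) :
    12 * cutSize (CCk k) S ≤ 10 * k^2 + 18 * k + 9 := by
  let x : ℕ → ℤ := fun i => if h : i < k + 1 then (if Sum.inl ⟨i, h⟩ ∈ S then 1 else -1) else 1
  let y : ℕ → ℤ := fun i => if h : i < k + 1 then (if Sum.inr ⟨i, h⟩ ∈ S then 1 else -1) else 1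
  have hcut := four_mul_cutSize_CCk k S x y (fun i => dif_pos i.isLt)
    (fun i => dif_pos i.isLt)
  obtain ⟨u, h, vp, vm, M, m, I, hX, hY, hn, hvp, hvm, hm, hM, hmu, huM, hh, hI, hT⟩ :=
    exists_walk_data x y (fun i => by grind) (fun i => by grind) (k + 1)
  have := walk_area_le hvp hvm hm hM hmu huM hh hI
  rw [hX, hY, hT] at hcut
  push_cast at hn
  rw [← hn] at this
  zify
  nlinarith

open Finset in
theorem sum_range_threshold {p n : ℕ} :
    ∑ i ∈ range n, (if i < p then (1 : ℤ) else -1) = if n ≤ p then (n : ℤ) else 2 * p - n := by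
  induction n with
  | zero => simp
  | succ n ih =>
    rw [Finset.sum_range_succ, ih]
    grind

open Finset in
theorem sum_range_threshold_mul {p q n : ℕ} (hqp : q ≤ p) :
    2 * ∑ i ∈ range n, (if i < q then (1 : ℤ) else -1)
      * ∑ j ∈ range i, (if j < p then (1 : ℤ) else -1)
    = if n ≤ q then (n : ℤ) * (n - 1) else if n ≤ p then 2 * (q : ℤ) * (q - 1) - n * (n - 1) else
      2 * (q : ℤ) * (q - 1) - 2 * p * (p - 1) - 4 * p * (n - p) + n * (n - 1) := by
  induction n with
  | zero => simp
  | succ n ih =>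
    rw [Finset.sum_range_succ, mul_add, ih, sum_range_threshold]
    rcases lt_trichotomy n q with h | rfl | h <;> rcases lt_trichotomy n p with h' | rfl | h' <;>
      grind

theorem exists_cutSize_CCk_lt (k : ℕ) :
    ∃ S, 10 * k^2 + 18 * k + 9 < 12 * cutSize (CCk k) S + 12 := by
  obtain ⟨v, hv⟩ : ∃ v, v = (k + 1) / 3 := ⟨_, rfl⟩
  obtain ⟨q, hq⟩ : ∃ q, q = (k + 1 - v) / 2 := ⟨_, rfl⟩
  let S : Finset (Fin (k+1) ⊕ Fin (k+1)) :=
    (Finset.univ.filter fun i : Fin (k+1) => (i : ℕ) < q).disjSum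
      (Finset.univ.filter fun j : Fin (k+1) => (j : ℕ) < q + v)
  refine ⟨S, ?_⟩
  have hcut := four_mul_cutSize_CCk k S (fun i => if i < q then 1 else -1)
    (fun i => if i < q + v then 1 else -1) (fun i => by simp [S]) (fun i => by simp [S])
  have hT := sum_range_threshold_mul (p := q + v) (q := q) (n := k + 1) (by omega)
  have hX : ∑ i ∈ Finset.range (k+1), (if i < q then (1 : ℤ) else -1) = 2 * q - (k + 1) := by
    rw [sum_range_threshold]
    grind
  have hY : ∑ i ∈ Finset.range (k+1), (if i < q + v then (1 : ℤ) else -1)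
      = 2 * (q + v) - (k + 1) := by
    rw [sum_range_threshold]
    grind
  have hT' : 2 * ∑ i ∈ Finset.range (k+1), (if i < q then (1 : ℤ) else -1)
      * ∑ j ∈ Finset.range i, (if j < q + v then (1 : ℤ) else -1)
      = 2 * (q : ℤ) * (q - 1) - 2 * (q + v) * (q + v - 1) - 4 * (q + v) * (k + 1 - (q + v))
        + (k + 1) * k := by
    rw [hT]
    grind
  rw [hX, hY, hT'] at hcut
  have ht : ((k : ℤ) + 1 - 3 * v - 1) ^ 2 ≤ 1 := by
    rw [sq_le_one_iff_abs_le_one, abs_le]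
    omega
  have hu : (2 * (q : ℤ) + v - (k + 1)) ^ 2 ≤ 1 := by
    rw [sq_le_one_iff_abs_le_one, abs_le]
    omega
  zify
  nlinarith

/-- The maximum cut size of `CC_k` equals `⌊(10k² + 18k + 9)/12⌋ = ⌊5k²/6 + 3k/2 + 3/4⌋`. -/
theorem CCk_maxCut (k : ℕ) : maxCut (CCk k) = (10 * k^2 + 18 * k + 9) / 12 := by
  apply le_antisymm
  · refine Finset.sup_le fun S _ => ?_
    have := twelve_mul_cutSize_CCk_le k S
    omega
  · obtain ⟨S, hS⟩ := exists_cutSize_CCk_lt k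
    have hle : cutSize (CCk k) S ≤ maxCut (CCk k) :=
      Finset.le_sup (f := fun S => cutSize (CCk k) S) (by simp)
    omega
end

section
/- For every natural number k, the maximum cut size of CC_k^- equals ⌊(10k² + 10k + 5)/12⌋, i.e., ⌊5k²/6 + 5k/6 + 5/12⌋. -/
def ccRelM (k : ℕ) : (Fin (k+1) ⊕ Fin k) → (Fin (k+1) ⊕ Fin k) → Prop
  | Sum.inl _, Sum.inl _ => True
  | Sum.inr _, Sum.inr _ => True
  | Sum.inl i, Sum.inr j => (j : ℕ) < (i : ℕ)
  | Sum.inr _, Sum.inl _ => False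

instance (k : ℕ) : DecidableRel (ccRelM k) := fun u v =>
  match u, v with
  | Sum.inl _, Sum.inl _ => inferInstanceAs (Decidable True)
  | Sum.inr _, Sum.inr _ => inferInstanceAs (Decidable True)
  | Sum.inl i, Sum.inr j => inferInstanceAs (Decidable ((j : ℕ) < (i : ℕ)))
  | Sum.inr _, Sum.inl _ => inferInstanceAs (Decidable False)

/-- The graph `CC_k^-`: the induced subgraph of `CC_k` obtained by deleting `v'_k`,
realized on the vertex set `{v_0,…,v_k} ⊕ {v'_0,…,v'_{k-1}}`. -/
def CCkMinus (k : ℕ) : SimpleGraph (Fin (k+1) ⊕ Fin k) := SimpleGraph.fromRel (ccRelM k)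

instance (k : ℕ) : DecidableRel (CCkMinus k).Adj := fun u v =>
  inferInstanceAs (Decidable (u ≠ v ∧ (ccRelM k u v ∨ ccRelM k v u)))

open Finset

/-- Four times the cut size of `CC_k^-`, in terms of a `±1`-valued encoding of the cut. -/
theorem four_mul_cutSize_CCkMinus (k : ℕ) (S : Finset (Fin (k + 1) ⊕ Fin k)) (x y : ℕ → ℤ)
    (hx : ∀ i : Fin (k + 1), x i = if Sum.inl i ∈ S then -1 else 1)
    (hy : ∀ j : Fin k, y j = if Sum.inr j ∈ S then -1 else 1) :
    4 * (cutSize (CCkMinus k) S : ℤ) =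
      ((k : ℤ) + 1) ^ 2 - (∑ i ∈ range (k + 1), x i) ^ 2 + (k : ℤ) ^ 2 - (∑ j ∈ range k, y j) ^ 2
        + 2 * ∑ i ∈ range (k + 1), ∑ j ∈ range i, (1 - x i * y j) := by
  have inner : ∀ i ∈ range (k + 1), ∑ j ∈ range i, (1 - x i * y j)
      = ∑ j ∈ range k, if j < i then 1 - x i * y j else 0 := by
    intro i hi
    rw [← sum_filter]
    congr 1
    ext j
    simp only [mem_range, mem_filter] at *
    omega
  have clique : ∀ (n : ℕ) (z : ℕ → ℤ), (n : ℤ) ^ 2 - (∑ i ∈ range n, z i) ^ 2 =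
      ∑ i : Fin n, ∑ j : Fin n, (1 + z j - z i - z i * z j) := by
    intro n z
    simp only [sum_sub_distrib, sum_add_distrib, ← mul_sum, ← sum_mul, sum_const, card_univ,
      Fintype.card_fin, nsmul_eq_mul, sum_range]
    ring
  rw [sum_congr rfl inner]
  have h1 := clique (k + 1) x
  have h2 := clique k y
  push_cast at h1
  have key : 4 * (cutSize (CCkMinus k) S : ℤ) =
      (∑ i : Fin (k + 1), ∑ j : Fin (k + 1), (1 + x j - x i - x i * x j))
      + (∑ i : Fin k, ∑ j : Fin k, (1 + y j - y i - y i * y j))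
      + ((∑ i : Fin (k + 1), ∑ j : Fin k,
          if (j : ℕ) < i then (1 + y j - x i - x i * y j) else 0)
        + ∑ j : Fin k, ∑ i : Fin (k + 1),
          if (j : ℕ) < i then (1 + x i - y j - x i * y j) else 0) := by
    have e1 : ∀ i j : Fin (k + 1), 4 * (if (CCkMinus k).Adj (Sum.inl i) (Sum.inl j) ∧
        Sum.inl i ∈ S ∧ Sum.inl j ∉ S then (1 : ℤ) else 0) = 1 + x j - x i - x i * x j := by
      intro i j
      rw [hx, hx]
      by_cases hij : i = j
      · subst hij; split_ifs <;> simp_all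
      · by_cases a : Sum.inl i ∈ S <;> by_cases b : Sum.inl j ∈ S <;>
          simp [a, b, hij, CCkMinus, SimpleGraph.fromRel_adj, ccRelM]
    have e2 : ∀ i j : Fin k, 4 * (if (CCkMinus k).Adj (Sum.inr i) (Sum.inr j) ∧
        Sum.inr i ∈ S ∧ Sum.inr j ∉ S then (1 : ℤ) else 0) = 1 + y j - y i - y i * y j := by
      intro i j
      rw [hy, hy]
      by_cases hij : i = j
      · subst hij; split_ifs <;> simp_all
      · by_cases a : Sum.inr i ∈ S <;> by_cases b : Sum.inr j ∈ S <;>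
          simp [a, b, hij, CCkMinus, SimpleGraph.fromRel_adj, ccRelM]
    have e3 : ∀ (i : Fin (k + 1)) (j : Fin k), 4 * (if (CCkMinus k).Adj (Sum.inl i) (Sum.inr j) ∧
        Sum.inl i ∈ S ∧ Sum.inr j ∉ S then (1 : ℤ) else 0) =
        if (j : ℕ) < i then (1 + y j - x i - x i * y j) else 0 := by
      intro i j
      rw [hx, hy]
      by_cases hij : (j : ℕ) < i <;> by_cases a : Sum.inl i ∈ S <;> by_cases b : Sum.inr j ∈ S <;>
          simp [a, b, hij, CCkMinus, SimpleGraph.fromRel_adj, ccRelM]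
    have e4 : ∀ (j : Fin k) (i : Fin (k + 1)), 4 * (if (CCkMinus k).Adj (Sum.inr j) (Sum.inl i) ∧
        Sum.inr j ∈ S ∧ Sum.inl i ∉ S then (1 : ℤ) else 0) =
        if (j : ℕ) < i then (1 + x i - y j - x i * y j) else 0 := by
      intro j i
      rw [hx, hy]
      by_cases hij : (j : ℕ) < i <;> by_cases a : Sum.inl i ∈ S <;> by_cases b : Sum.inr j ∈ S <;>
          simp [a, b, hij, CCkMinus, SimpleGraph.fromRel_adj, ccRelM]
    rw [cutSize, card_filter]
    push_cast
    rw [Fintype.sum_prod_type]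
    simp only [Fintype.sum_sum_type, sum_add_distrib, mul_add, mul_sum, e1, e2, e3, e4]
    ring
  have cross : (∑ i : Fin (k + 1), ∑ j : Fin k,
          if (j : ℕ) < i then (1 + y j - x i - x i * y j) else 0)
        + (∑ j : Fin k, ∑ i : Fin (k + 1),
          if (j : ℕ) < i then (1 + x i - y j - x i * y j) else 0)
      = 2 * ∑ i ∈ range (k + 1), ∑ j ∈ range k, if j < i then 1 - x i * y j else 0 := by
    rw [sum_comm (s := (univ : Finset (Fin k)))]
    simp only [sum_range, mul_sum, ← sum_add_distrib]
    refine sum_congr rfl fun i _ => sum_congr rfl fun j _ => ?_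
    split_ifs <;> ring
  rw [key, cross, ← h1, ← h2]
  ring

/-- The cut size of `CC_k^-` as a quadratic form in a `±1`-valued encoding of the cut. -/
theorem twelve_mul_cutSize_CCkMinus (k : ℕ) (S : Finset (Fin (k + 1) ⊕ Fin k)) (x y : ℕ → ℤ)
    (hx : ∀ i : Fin (k + 1), x i = if Sum.inl i ∈ S then -1 else 1)
    (hy : ∀ j : Fin k, y j = if Sum.inr j ∈ S then -1 else 1) :
    12 * (cutSize (CCkMinus k) S : ℤ) = 9 * ((k : ℤ) ^ 2 + k) + 3
      - (3 * (∑ i ∈ range (k + 1), x i) ^ 2 + 3 * (∑ j ∈ range k, y j) ^ 2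
        + 6 * ∑ i ∈ range (k + 1), x i * ∑ j ∈ range i, y j) := by
  have h := four_mul_cutSize_CCkMinus k S x y hx hy
  have g : 2 * ∑ i ∈ range (k + 1), (i : ℤ) = (k : ℤ) ^ 2 + k := by
    have := Finset.sum_range_id_mul_two (k + 1)
    rw [Nat.add_sub_cancel] at this
    have h' : ((∑ i ∈ range (k + 1), i : ℕ) : ℤ) * 2 = ((k + 1) * k : ℕ) := by exact_mod_cast this
    push_cast at h'
    linarith
  simp only [sum_sub_distrib, ← mul_sum, sum_const, card_range, nsmul_eq_mul, mul_one] at h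
  linarith

/-- The range of a walk on `ℤ` starting at `0`, bounded by its total variation once the walk is
closed up. -/
theorem exists_bounds_partial_sums (a : ℕ → ℤ) (n : ℕ) :
    ∃ m M : ℤ, (∀ j ≤ n, m ≤ ∑ i ∈ range j, a i ∧ ∑ i ∈ range j, a i ≤ M) ∧
      2 * (M - m) ≤ ∑ i ∈ range n, |a i| + |∑ i ∈ range n, a i| := by
  induction n with
  | zero => exact ⟨0, 0, by simp, by simp⟩
  | succ n ih =>
    obtain ⟨m, M, hb, hv⟩ := ih
    have h0 := hb 0 (Nat.zero_le n)
    have hn := hb n le_rfl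
    rw [range_zero, sum_empty] at h0
    rw [sum_range_succ, sum_range_succ]
    refine ⟨min m (∑ i ∈ range n, a i + a n), max M (∑ i ∈ range n, a i + a n), ?_, ?_⟩
    · intro j hj
      rcases Nat.le_succ_iff.mp hj with hj | rfl
      · have := hb j hj
        omega
      · rw [sum_range_succ]
        omega
    · have h1 := abs_cases (a n)
      have h2 := abs_cases (∑ i ∈ range n, a i)
      have h3 := abs_cases (∑ i ∈ range n, a i + a n)
      omega

/-- An isoperimetric inequality for the signed area of a planar walk with axis-parallel steps
whose horizontal and vertical steps are `a` and `b`. -/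
theorem le_signed_area (a b : ℕ → ℤ) (n : ℕ) :
    2 * |∑ i ∈ range n, b i| * |∑ i ∈ range n, a i|
      - (∑ i ∈ range n, |b i| + |∑ i ∈ range n, b i|)
        * (∑ i ∈ range n, |a i| + |∑ i ∈ range n, a i|)
      ≤ 2 * (2 * ∑ j ∈ range n, b j * ∑ i ∈ range j, a i
        - (∑ i ∈ range n, b i) * ∑ i ∈ range n, a i) := by
  obtain ⟨m, M, hb, hv⟩ := exists_bounds_partial_sums a n
  have h0 := hb 0 (Nat.zero_le n)
  have hn := hb n le_rfl
  rw [range_zero, sum_empty] at h0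
  set U := ∑ i ∈ range n, a i
  set W := ∑ i ∈ range n, b i with hW
  set N := ∑ i ∈ range n, |b i| with hN
  have area : -(M - m) * N ≤ 2 * (∑ j ∈ range n, b j * ∑ i ∈ range j, a i) - (M + m) * W := by
    rw [hN, hW, mul_sum, mul_sum, mul_sum, ← sum_sub_distrib]
    refine sum_le_sum fun j hj => ?_
    have hj' := hb j (mem_range.mp hj).le
    rcases abs_cases (b j) with ⟨e, _⟩ | ⟨e, _⟩ <;> rw [e] <;> nlinarith
  have hN0 : 0 ≤ N := sum_nonneg fun i _ => abs_nonneg _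
  have hclose : -(M - m) * |W| + |W| * |U| ≤ (M + m) * W - W * U := by
    rcases abs_cases W with ⟨e, _⟩ | ⟨e, _⟩ <;> rcases abs_cases U with ⟨e', _⟩ | ⟨e', _⟩ <;>
      rw [e, e'] <;> nlinarith
  have hprod := mul_le_mul_of_nonneg_left hv (add_nonneg hN0 (abs_nonneg W))
  nlinarith

/-- The quadratic form of `CC_k^-` in rotated coordinates `x = a + b`, `y = a - b`. -/
theorem two_mul_sum_mul_partial_sums (a b : ℕ → ℤ) (n : ℕ) (hab : ∀ i, a i * b i = 0)
    (hsq : ∀ i, |a i| + |b i| = 1) :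
    2 * ∑ i ∈ range n, (a i + b i) * ∑ j ∈ range i, (a j - b j) =
      (∑ i ∈ range n, a i) ^ 2 - ∑ i ∈ range n, |a i| - (∑ i ∈ range n, b i) ^ 2
        + ∑ i ∈ range n, |b i| + 2 * (2 * ∑ j ∈ range n, b j * ∑ i ∈ range j, a i
        - (∑ i ∈ range n, b i) * ∑ i ∈ range n, a i) := by
  induction n with
  | zero => simp
  | succ n ih =>
    simp only [sum_range_succ, mul_add, sum_sub_distrib] at *
    have ha : |a n| = a n ^ 2 := by
      have h1 := hab n
      have h2 := hsq n
      rcases mul_eq_zero.mp h1 with h | h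
      · simp [h]
      · rw [h, abs_zero, add_zero] at h2
        rw [← sq_abs, h2, one_pow]
    have hb : |b n| = b n ^ 2 := by
      have h1 := hab n
      have h2 := hsq n
      rcases mul_eq_zero.mp h1 with h | h
      · rw [h, abs_zero, zero_add] at h2
        rw [← sq_abs, h2, one_pow]
      · simp [h]
    rw [ha, hb]
    linear_combination ih + 2 * hab n

theorem CCkMinus_quadratic_form_ge (k : ℕ) (x y : ℕ → ℤ) (hx : ∀ i, x i = -1 ∨ x i = 1)
    (hy : ∀ i, y i = -1 ∨ y i = 1) :
    -((k : ℤ) ^ 2 + k + 1) ≤ 3 * (∑ i ∈ range (k + 1), x i) ^ 2 + 3 * (∑ j ∈ range k, y j) ^ 2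
        + 6 * ∑ i ∈ range (k + 1), x i * ∑ j ∈ range i, y j := by
  obtain ⟨a, ha⟩ : ∃ a : ℕ → ℤ, ∀ i, 2 * a i = x i + y i :=
    ⟨fun i => (x i + y i) / 2, fun i => by dsimp only; have := hx i; have := hy i; omega⟩
  obtain ⟨b, hb⟩ : ∃ b : ℕ → ℤ, ∀ i, 2 * b i = x i - y i :=
    ⟨fun i => (x i - y i) / 2, fun i => by dsimp only; have := hx i; have := hy i; omega⟩
  have hab : ∀ i, a i * b i = 0 := by
    intro i
    have := hx i; have := hy i; have := ha i; have := hb i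
    rw [mul_eq_zero]
    omega
  have hsq : ∀ i, |a i| + |b i| = 1 := by
    intro i
    have := hx i; have := hy i; have := ha i; have := hb i
    have := abs_cases (a i); have := abs_cases (b i)
    omega
  have hxe : ∀ i, x i = a i + b i := fun i => by linarith [ha i, hb i]
  have hye : ∀ i, y i = a i - b i := fun i => by linarith [ha i, hb i]
  have hs : x k ^ 2 = 1 := by rcases hx k with h | h <;> rw [h] <;> norm_num
  have id1 := two_mul_sum_mul_partial_sums a b k hab hsq
  have ar := le_signed_area a b k
  have hlen : ∑ i ∈ range k, |a i| + ∑ i ∈ range k, |b i| = k := by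
    rw [← sum_add_distrib, sum_congr rfl fun i _ => hsq i]
    simp
  have hX : ∑ i ∈ range k, x i = ∑ i ∈ range k, a i + ∑ i ∈ range k, b i := by
    rw [← sum_add_distrib]; exact sum_congr rfl fun i _ => hxe i
  have hY : ∀ n, ∑ i ∈ range n, y i = ∑ i ∈ range n, (a i - b i) := fun n =>
    sum_congr rfl fun i _ => hye i
  have hC : ∑ i ∈ range k, x i * ∑ j ∈ range i, y j =
      ∑ i ∈ range k, (a i + b i) * ∑ j ∈ range i, (a j - b j) :=
    sum_congr rfl fun i _ => by rw [hxe, hY]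
  rw [sum_range_succ, sum_range_succ (fun i => x i * _), hC, hX, hY, sum_sub_distrib]
  generalize (∑ i ∈ range k, (a i + b i) * ∑ j ∈ range i, (a j - b j)) = C at *
  generalize (∑ j ∈ range k, b j * ∑ i ∈ range j, a i) = R at *
  generalize (∑ i ∈ range k, |a i|) = p at *
  generalize (∑ i ∈ range k, |b i|) = q at *
  generalize (∑ i ∈ range k, a i) = U at *
  generalize (∑ i ∈ range k, b i) = W at *
  have hsU : -|U| ≤ x k * U := by
    rcases hx k with h | h <;> rw [h] <;> rcases abs_cases U with ⟨e, _⟩ | ⟨e, _⟩ <;>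
      rw [e] <;> linarith
  have hU2 := sq_abs U
  have hW2 := sq_abs W
  have hu0 := abs_nonneg U
  generalize |U| = u at *
  generalize |W| = w at *
  obtain rfl : p = k - q := by linarith
  have huu : 0 ≤ u * (u - 1) := by
    rcases hu0.eq_or_lt with h | h
    · simp [← h]
    · exact mul_nonneg hu0 (by linarith)
  have s1 := sq_nonneg ((q + w + 1) - (k - q + u - 1))
  have s2 := sq_nonneg ((k : ℤ) - 3 * (w + u) + 2)
  nlinarith

theorem sum_threshold (h n : ℕ) :
    ∑ i ∈ range n, (if i < h then (-1 : ℤ) else 1) = if n ≤ h then -(n : ℤ) else n - 2 * h := by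
  induction n with
  | zero => simp
  | succ n ih =>
    rw [sum_range_succ, ih]
    push_cast
    split_ifs <;> omega

theorem two_mul_sum_threshold_mul (g h : ℕ) (hgh : g ≤ h) (n : ℕ) :
    2 * ∑ i ∈ range n, (if i < g then (-1 : ℤ) else 1)
        * (∑ j ∈ range i, if j < h then (-1 : ℤ) else 1) =
      if n ≤ g then (n : ℤ) * (n - 1)
      else if n ≤ h then 2 * g * (g - 1) - (n : ℤ) * (n - 1)
      else 2 * g * (g - 1) + (n : ℤ) * (n - 1) - 2 * h * (h - 1) - 4 * h * (n - h) := by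
  simp only [sum_threshold]
  induction n with
  | zero => simp
  | succ n ih =>
    rw [sum_range_succ, mul_add, ih]
    push_cast
    rcases lt_trichotomy n g with h1 | h1 | h1 <;> rcases lt_trichotomy n h with h2 | h2 | h2 <;>
      first
      | omega
      | (subst_vars
         split_ifs <;> first | omega | ring)

/-- The maximum cut size of `CC_k^-` equals `⌊(10k² + 10k + 5)/12⌋ = ⌊5k²/6 + 5k/6 + 5/12⌋`. -/
theorem CCkMinus_maxCut (k : ℕ) : maxCut (CCkMinus k) = (10 * k^2 + 10 * k + 5) / 12 := by
  apply le_antisymm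
  · refine Finset.sup_le fun S _ => ?_
    obtain ⟨x, hx⟩ : ∃ x : ℕ → ℤ, x = fun i =>
      if ∃ h : i < k + 1, Sum.inl ⟨i, h⟩ ∈ S then -1 else 1 := ⟨_, rfl⟩
    obtain ⟨y, hy⟩ : ∃ y : ℕ → ℤ, y = fun i =>
      if ∃ h : i < k, Sum.inr ⟨i, h⟩ ∈ S then -1 else 1 := ⟨_, rfl⟩
    have hcut := twelve_mul_cutSize_CCkMinus k S x y (by intro i; simp [hx, i.is_le])
      (by intro i; simp [hy])
    have hge := CCkMinus_quadratic_form_ge k x y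
      (by intro i; simp only [hx]; split_ifs <;> simp)
      (by intro i; simp only [hy]; split_ifs <;> simp)
    rw [Nat.le_div_iff_mul_le (by norm_num)]
    have hle : 12 * (cutSize (CCkMinus k) S : ℤ) ≤ 10 * k ^ 2 + 10 * k + 4 := by linarith
    have : 12 * cutSize (CCkMinus k) S ≤ 10 * k ^ 2 + 10 * k + 4 := by exact_mod_cast hle
    omega
  · let g := (k + 2) / 3
    let h := k - (k + 1) / 3
    let S : Finset (Fin (k + 1) ⊕ Fin k) :=
      univ.filter fun v => Sum.elim (fun i : Fin (k + 1) => decide ((i : ℕ) < g))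
        (fun j : Fin k => decide ((j : ℕ) < h)) v
    refine le_trans ?_ (Finset.le_sup (f := fun S => cutSize (CCkMinus k) S)
      (mem_powerset.mpr (subset_univ S)))
    have hcut := twelve_mul_cutSize_CCkMinus k S (fun i => if i < g then -1 else 1)
      (fun j => if j < h then -1 else 1) (by intro i; simp [S]) (by intro j; simp [S])
    have hC := two_mul_sum_threshold_mul g h (by omega) (k + 1)
    have hY : (if k ≤ h then -(k : ℤ) else k - 2 * h) = k - 2 * h := by split_ifs <;> omega
    rw [sum_threshold, sum_threshold, if_neg (by omega), hY] at hcut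
    rw [if_neg (by omega), if_neg (by omega)] at hC
    rw [← Nat.lt_succ_iff, Nat.div_lt_iff_lt_mul (by norm_num)]
    zify
    push_cast at hcut hC ⊢
    obtain ⟨l, hl | hl | hl⟩ : ∃ l, k = 3 * l ∧ g = l ∧ h = 2 * l ∨
        k = 3 * l + 1 ∧ g = l + 1 ∧ h = 2 * l + 1 ∨ k = 3 * l + 2 ∧ g = l + 1 ∧ h = 2 * l + 1 :=
      ⟨k / 3, by omega⟩
    all_goals
      obtain ⟨hk, hg, hh⟩ := hl
      zify at hk hg hh
      rw [hg, hh] at hcut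
      rw [hg, hh] at hC
      rw [hk] at hcut hC ⊢
      linarith
end
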